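/- arXiv:2505.06717 — 7 statements merged into one kernel-verified Lean document; each statement's English description precedes it below -/
import Mathlib

section
/- Let I be an SR instance with an even number n of agents whose preferences are asymmetric. Then the matching that pairs every agent with its middle agent (the agent at rank n/2 in its preference list) is a perfect matching and is stable; in particular, I is solvable. -/
/-- An SR instance with `n` agents. `rank i j` is the position (starting at 1) of
agent `j` in agent `i`'s preference list; by convention `rank i i = n`, encoding
that an agent prefers every other agent to itself. -/
structure SRInstance (n : ℕ) where
  rank : Fin n → Fin n → ℕ
  rank_self : ∀ i, rank i i = n
  rank_bijOn : ∀ i, Set.BijOn (rank i) {j | j ≠ i} (Set.Icc 1 (n - 1))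

variable {n : ℕ}

/-- `M` is a matching, encoded as an involution; `M i = i` means `i` is unmatched. -/
def IsMatching (M : Fin n → Fin n) : Prop := ∀ i, M (M i) = i

/-- The pair `{i, j}` blocks the matching `M`. -/
def Blocks (I : SRInstance n) (M : Fin n → Fin n) (i j : Fin n) : Prop :=
  i ≠ j ∧ (M i = i ∨ I.rank i j < I.rank i (M i)) ∧ (M j = j ∨ I.rank j i < I.rank j (M j))

def IsStableMatching (I : SRInstance n) (M : Fin n → Fin n) : Prop :=
  IsMatching M ∧ ∀ i j, ¬ Blocks I M i j

def Solvable (I : SRInstance n) : Prop := ∃ M, IsStableMatching I M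

/-- A stable partition: (T1) every agent weakly prefers its successor to its
predecessor, and (T2) no two distinct agents each strictly prefer the other to
their respective predecessors. -/
def IsStablePartition (I : SRInstance n) (σ : Equiv.Perm (Fin n)) : Prop :=
  (∀ a, I.rank a (σ a) ≤ I.rank a (σ⁻¹ a)) ∧
  ¬ ∃ i j : Fin n, i ≠ j ∧ I.rank i j < I.rank i (σ⁻¹ i) ∧ I.rank j i < I.rank j (σ⁻¹ j)

/-- The orbit (cycle) of `σ` containing `a`, as a finset. -/
def orbitOf (σ : Equiv.Perm (Fin n)) (a : Fin n) : Finset (Fin n) :=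
  Finset.univ.filter (fun b => σ.SameCycle a b)

/-- The number of cycles of odd length of the permutation `σ`. -/
def oddCycleCount (σ : Equiv.Perm (Fin n)) : ℕ :=
  ((Finset.univ.image (fun a => orbitOf σ a)).filter (fun s => Odd s.card)).card

/-- The cycle of `σ` at `a`, recorded as its orbit together with the cyclic
permutation induced on it (identity off the orbit). -/
def cycleAt (σ : Equiv.Perm (Fin n)) (a : Fin n) : Finset (Fin n) × Equiv.Perm (Fin n) :=
  (orbitOf σ a, σ.cycleOf a)

/-- The stable cycles of `I`: cycles occurring in some stable partition of `I`. -/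
def stableCycles (I : SRInstance n) : Set (Finset (Fin n) × Equiv.Perm (Fin n)) :=
  {c | ∃ (σ : Equiv.Perm (Fin n)) (a : Fin n), IsStablePartition I σ ∧ cycleAt σ a = c}

/-- The reduced stable cycles of `I`: stable cycles of length 2 or of odd length. -/
def reducedStableCycles (I : SRInstance n) : Set (Finset (Fin n) × Equiv.Perm (Fin n)) :=
  {c | c ∈ stableCycles I ∧ (c.1.card = 2 ∨ Odd c.1.card)}

/-- For an SR instance with an even number `n` of agents and
asymmetric preferences, the matching pairing every agent with its middle agent
(the agent at rank `n / 2` in its list) is a perfect matching and is stable;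
in particular `I` is solvable. -/
theorem middle_matching_perfect_and_stable {n : ℕ} (hn : Even n) (I : SRInstance n)
    (hasym : ∀ i j : Fin n, i ≠ j → I.rank j i = n - I.rank i j) :
    ∃ M : Fin n → Fin n,
      (∀ i, I.rank i (M i) = n / 2) ∧
      IsMatching M ∧ (∀ i, M i ≠ i) ∧ IsStableMatching I M ∧ Solvable I := by
  have exists_middle (i : Fin n) : ∃ j, j ≠ i ∧ I.rank i j = n / 2 := by
    have hmem : n / 2 ∈ Set.Icc 1 (n - 1) := by
      have := i.pos
      obtain ⟨k, rfl⟩ := hn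
      constructor <;> omega
    obtain ⟨j, hj, hrank⟩ := (I.rank_bijOn i).surjOn hmem
    exact ⟨j, hj, hrank⟩
  choose M hM_ne hM_rank using exists_middle
  have hM : IsMatching M := fun i => by
    refine (I.rank_bijOn (M i)).injOn (hM_ne (M i)) (hM_ne i).symm ?_
    rw [hM_rank, hasym i (M i) (hM_ne i).symm, hM_rank]
    obtain ⟨k, rfl⟩ := hn
    omega
  have hstable : IsStableMatching I M := by
    refine ⟨hM, fun i j ⟨hij, hi, hj⟩ => ?_⟩
    have hi := hi.resolve_left (hM_ne i)
    have hj := hj.resolve_left (hM_ne j)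
    rw [hM_rank] at hi hj
    rw [hasym i j hij] at hj
    omega
  exact ⟨M, hM_rank, hM, hM_ne, hstable, M, hstable⟩
end

section
/- Let I be an SR instance with an even number n of agents whose preferences are symmetric. Then the matching M that pairs every agent with its first choice is a well-defined perfect matching and is stable. -/
variable {n : ℕ}

/-- If `n ≠ 1`, only a genuine other agent can be ranked first. -/
theorem SRInstance.ne_of_rank_eq_one {n : ℕ} (hn : n ≠ 1) (I : SRInstance n) {i j : Fin n}
    (h : I.rank i j = 1) : j ≠ i := by
  rintro rfl
  exact hn ((I.rank_self j).symm.trans h)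

theorem SRInstance.eq_of_rank_eq_one {n : ℕ} (hn : n ≠ 1) (I : SRInstance n) {i j k : Fin n}
    (hj : I.rank i j = 1) (hk : I.rank i k = 1) : j = k :=
  (I.rank_bijOn i).injOn (I.ne_of_rank_eq_one hn hj) (I.ne_of_rank_eq_one hn hk)
    (hj.trans hk.symm)

theorem SRInstance.exists_rank_eq_one {n : ℕ} (hn : n ≠ 1) (I : SRInstance n) (i : Fin n) :
    ∃ j, I.rank i j = 1 := by
  have hi := i.isLt
  obtain ⟨j, -, hj⟩ := (I.rank_bijOn i).surjOn (show 1 ∈ Set.Icc 1 (n - 1) from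
    ⟨le_rfl, by omega⟩)
  exact ⟨j, hj⟩

theorem SRInstance.one_le_rank {n : ℕ} (I : SRInstance n) {i j : Fin n} (h : j ≠ i) :
    1 ≤ I.rank i j :=
  ((I.rank_bijOn i).mapsTo h).1

/-- For an SR instance with an even number `n` of agents and
symmetric preferences, the matching pairing every agent with its first choice
is a well-defined perfect matching and is stable. -/
theorem first_choice_matching_perfect_and_stable {n : ℕ} (hn : Even n) (I : SRInstance n)
    (hsym : ∀ i j : Fin n, i ≠ j → I.rank j i = I.rank i j) :
    (∃! M : Fin n → Fin n, ∀ i, I.rank i (M i) = 1) ∧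
    ∀ M : Fin n → Fin n, (∀ i, I.rank i (M i) = 1) →
      IsMatching M ∧ (∀ i, M i ≠ i) ∧ IsStableMatching I M := by
  have hn1 : n ≠ 1 := by
    rintro rfl
    exact Nat.not_even_one hn
  refine ⟨?_, fun M hM => ?_⟩
  · choose M hM using I.exists_rank_eq_one hn1
    exact ⟨M, hM, fun N hN => funext fun i => I.eq_of_rank_eq_one hn1 (hN i) (hM i)⟩
  · have hne : ∀ i, M i ≠ i := fun i => I.ne_of_rank_eq_one hn1 (hM i)
    have hmatch : IsMatching M := fun i =>
      I.eq_of_rank_eq_one hn1 (hM (M i)) ((hsym i (M i) (hne i).symm).trans (hM i))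
    refine ⟨hmatch, hne, hmatch, fun i j ⟨hij, hi, _⟩ => ?_⟩
    have hlt := hi.resolve_left (hne i)
    rw [hM i] at hlt
    exact absurd (I.one_le_rank hij.symm) (not_le.mpr hlt)
end

section
/- Let I be an SR instance with an even number n of agents whose preferences are symmetric. Then I admits a unique stable partition, namely the permutation whose cycles are exactly the transpositions pairing every agent with its first choice; in particular, the first-choice matching is the unique stable matching of I. -/
variable {n : ℕ}

namespace SRInstance

theorem one_le_rank_s4 (I : SRInstance n) (i j : Fin n) : 1 ≤ I.rank i j := by
  by_cases h : j = i
  · have := I.rank_self i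
    have := i.isLt
    subst h
    omega
  · exact ((I.rank_bijOn i).mapsTo h).1

theorem eq_of_rank_eq_one_s4 (I : SRInstance n) (hn : Even n) {i j k : Fin n}
    (hj : I.rank i j = 1) (hk : I.rank i k = 1) : j = k := by
  have ne_self : ∀ l, I.rank i l = 1 → l ≠ i := by
    rintro l hl rfl
    rw [I.rank_self] at hl
    subst hl
    exact Nat.not_even_one hn
  exact (I.rank_bijOn i).injOn (ne_self j hj) (ne_self k hk) (hj.trans hk.symm)

theorem exists_firstChoice (I : SRInstance n) (hn : Even n)
    (hsym : ∀ i j : Fin n, i ≠ j → I.rank j i = I.rank i j) :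
    ∃ f : Fin n → Fin n, Function.Involutive f ∧ ∀ i, f i ≠ i ∧ I.rank i (f i) = 1 := by
  have first : ∀ i, ∃ j, j ≠ i ∧ I.rank i j = 1 := by
    intro i
    have hi := i.isLt
    obtain ⟨m, hm⟩ := hn
    exact (I.rank_bijOn i).surjOn ⟨le_rfl, by omega⟩
  choose f hf using first
  refine ⟨f, fun i => I.eq_of_rank_eq_one_s4 hn (hf (f i)).2 ?_, hf⟩
  rw [hsym i (f i) (hf i).1.symm, (hf i).2]

end SRInstance

theorem IsStablePartition.apply_eq {I : SRInstance n} (hn : Even n) {f : Fin n → Fin n}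
    (hinv : Function.Involutive f) (hf : ∀ i, f i ≠ i ∧ I.rank i (f i) = 1)
    {σ : Equiv.Perm (Fin n)} (hσ : IsStablePartition I σ) (a : Fin n) : σ a = f a := by
  by_cases ha : I.rank a (σ⁻¹ a) = 1
  · exact I.eq_of_rank_eq_one_s4 hn
      (le_antisymm ((hσ.1 a).trans ha.le) (I.one_le_rank_s4 _ _)) (hf a).2
  · have hfa := (hf (f a)).2
    rw [hinv a] at hfa
    have hb : I.rank (f a) (σ⁻¹ (f a)) = 1 := by
      by_contra hb
      refine hσ.2 ⟨a, f a, (hf a).1.symm, ?_, ?_⟩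
      · rw [(hf a).2]
        exact lt_of_le_of_ne (I.one_le_rank_s4 _ _) (Ne.symm ha)
      · rw [hfa]
        exact lt_of_le_of_ne (I.one_le_rank_s4 _ _) (Ne.symm hb)
    exact (Equiv.Perm.inv_eq_iff_eq.mp (I.eq_of_rank_eq_one_s4 hn hb hfa)).symm

theorem IsStableMatching.apply_eq {I : SRInstance n} (hn : Even n) {f : Fin n → Fin n}
    (hinv : Function.Involutive f) (hf : ∀ i, f i ≠ i ∧ I.rank i (f i) = 1)
    {M : Fin n → Fin n} (hM : IsStableMatching I M) (a : Fin n) : M a = f a := by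
  by_cases ha : I.rank a (M a) = 1
  · exact I.eq_of_rank_eq_one_s4 hn ha (hf a).2
  · have hfa := (hf (f a)).2
    rw [hinv a] at hfa
    have hb : I.rank (f a) (M (f a)) = 1 := by
      by_contra hb
      refine hM.2 a (f a) ⟨(hf a).1.symm, Or.inr ?_, Or.inr ?_⟩
      · rw [(hf a).2]
        exact lt_of_le_of_ne (I.one_le_rank_s4 _ _) (Ne.symm ha)
      · rw [hfa]
        exact lt_of_le_of_ne (I.one_le_rank_s4 _ _) (Ne.symm hb)
    rw [← hM.1 (f a), I.eq_of_rank_eq_one_s4 hn hb hfa]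

theorem isStablePartition_firstChoice {I : SRInstance n} {f : Fin n → Fin n}
    (hinv : Function.Involutive f) (hf : ∀ i, f i ≠ i ∧ I.rank i (f i) = 1) :
    IsStablePartition I hinv.toPerm := by
  have h : ∀ a, (hinv.toPerm)⁻¹ a = f a := fun _ => rfl
  refine ⟨fun a => le_rfl, ?_⟩
  rintro ⟨i, j, -, hlt, -⟩
  rw [h, (hf i).2] at hlt
  exact (I.one_le_rank_s4 i j).not_gt hlt

theorem isStableMatching_firstChoice {I : SRInstance n} {f : Fin n → Fin n}
    (hinv : Function.Involutive f) (hf : ∀ i, f i ≠ i ∧ I.rank i (f i) = 1) :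
    IsStableMatching I f := by
  refine ⟨hinv, ?_⟩
  rintro i j ⟨-, hi | hlt, -⟩
  · exact (hf i).1 hi
  · rw [(hf i).2] at hlt
    exact (I.one_le_rank_s4 i j).not_gt hlt

/-- An SR instance with an even number of agents and symmetric
preferences admits a unique stable partition, namely the involution pairing
every agent with its first choice; in particular the first-choice matching is
the unique stable matching. -/
theorem symmetric_unique_stable_partition {n : ℕ} (hn : Even n) (I : SRInstance n)
    (hsym : ∀ i j : Fin n, i ≠ j → I.rank j i = I.rank i j) :
    (∃! σ : Equiv.Perm (Fin n), IsStablePartition I σ) ∧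
    (∀ σ : Equiv.Perm (Fin n), IsStablePartition I σ →
      ∀ a, I.rank a (σ a) = 1 ∧ σ (σ a) = a ∧ σ a ≠ a) ∧
    (∃! M : Fin n → Fin n, IsStableMatching I M) ∧
    (∀ M : Fin n → Fin n, IsStableMatching I M → ∀ i, I.rank i (M i) = 1) := by
  obtain ⟨f, hinv, hf⟩ := I.exists_firstChoice hn hsym
  refine ⟨⟨hinv.toPerm, isStablePartition_firstChoice hinv hf,
      fun σ hσ => Equiv.ext fun a => hσ.apply_eq hn hinv hf a⟩, fun σ hσ a => ?_,
    ⟨f, isStableMatching_firstChoice hinv hf, fun M hM => funext fun a => hM.apply_eq hn hinv hf a⟩,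
    fun M hM i => ?_⟩
  · simp only [hσ.apply_eq hn hinv hf]
    exact ⟨(hf a).2, hinv a, (hf a).1⟩
  · rw [hM.apply_eq hn hinv hf]
    exact (hf i).2
end

section
/- There exists an SR instance with 6 agents whose preferences are asymmetric and which admits at least two distinct stable matchings; hence an SR instance with an even number of agents and asymmetric preferences need not have a unique stable partition. -/
variable {n : ℕ}

/-- A stable matching, viewed as an involutive permutation, is a stable partition. -/
theorem IsStableMatching.isStablePartition {I : SRInstance n} {M : Fin n → Fin n}
    (h : IsStableMatching I M) :
    IsStablePartition I (Function.Involutive.toPerm M h.1) := by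
  refine ⟨fun a => le_rfl, ?_⟩
  rintro ⟨i, j, hij, hi, hj⟩
  exact h.2 i j ⟨hij, Or.inr hi, Or.inr hj⟩

/-- Distinct stable matchings rule out a unique stable partition. -/
theorem not_existsUnique_isStablePartition {I : SRInstance n} {M₁ M₂ : Fin n → Fin n}
    (h₁ : IsStableMatching I M₁) (h₂ : IsStableMatching I M₂) (hne : M₁ ≠ M₂) :
    ¬ ∃! σ : Equiv.Perm (Fin n), IsStablePartition I σ := fun h =>
  hne (congrArg (fun σ : Equiv.Perm (Fin n) => (σ : Fin n → Fin n))
    (h.unique h₁.isStablePartition h₂.isStablePartition))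

/-- The rank matrix of an asymmetric instance with two stable matchings. -/
def asymmetricRank : Fin 6 → Fin 6 → ℕ :=
  ![![6, 1, 2, 3, 4, 5],
    ![5, 6, 1, 4, 2, 3],
    ![4, 5, 6, 1, 3, 2],
    ![3, 2, 5, 6, 1, 4],
    ![2, 4, 3, 5, 6, 1],
    ![1, 3, 4, 2, 5, 6]]

/-- An asymmetric instance with two stable matchings. -/
def asymmetricInstance : SRInstance 6 where
  rank := asymmetricRank
  rank_self := by decide
  rank_bijOn i := by
    refine ⟨?_, ?_, ?_⟩
    · have h : ∀ i j : Fin 6, j ≠ i → 1 ≤ asymmetricRank i j ∧ asymmetricRank i j ≤ 5 := by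
        decide
      exact fun j hj => h i j hj
    · have h : ∀ i j k : Fin 6, asymmetricRank i j = asymmetricRank i k → j = k := by
        decide
      exact fun j _ k _ hjk => h i j k hjk
    · have h : ∀ i : Fin 6, ∀ r ∈ Finset.Icc 1 5, ∃ j, j ≠ i ∧ asymmetricRank i j = r := by
        decide
      exact fun r hr => h i r (Finset.mem_Icc.mpr hr)

theorem isStableMatching_asymmetricInstance_left :
    IsStableMatching asymmetricInstance ![3, 4, 5, 0, 1, 2] := by
  unfold IsStableMatching IsMatching Blocks
  decide

theorem isStableMatching_asymmetricInstance_right :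
    IsStableMatching asymmetricInstance ![3, 5, 4, 0, 2, 1] := by
  unfold IsStableMatching IsMatching Blocks
  decide

/-- There is an SR instance with 6 agents and asymmetric preferences
admitting two distinct stable matchings; hence (even `n`, asymmetric preferences)
does not force a unique stable partition. -/
theorem exists_asymmetric_two_stable_matchings :
    ∃ I : SRInstance 6,
      (∀ i j : Fin 6, i ≠ j → I.rank j i = 6 - I.rank i j) ∧
      (∃ M₁ M₂ : Fin 6 → Fin 6,
        IsStableMatching I M₁ ∧ IsStableMatching I M₂ ∧ M₁ ≠ M₂) ∧
      ¬ (∃! σ : Equiv.Perm (Fin 6), IsStablePartition I σ) := by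
  have hne : (![3, 4, 5, 0, 1, 2] : Fin 6 → Fin 6) ≠ ![3, 5, 4, 0, 2, 1] := by decide
  exact ⟨asymmetricInstance, by decide,
    ⟨_, _, isStableMatching_asymmetricInstance_left,
      isStableMatching_asymmetricInstance_right, hne⟩,
    not_existsUnique_isStablePartition isStableMatching_asymmetricInstance_left
      isStableMatching_asymmetricInstance_right hne⟩
end

section
/- Let I be an SR instance with n ≥ 2 agents that is solvable. Then every stable partition of I contains exactly 0 cycles of odd length if n is even, and exactly 1 cycle of odd length (which is a fixed point) if n is odd. -/
variable {n : ℕ}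

theorem SRInstance.rank_injective (I : SRInstance n) (i : Fin n) :
    Function.Injective (I.rank i) := by
  intro j k h
  have hi := I.rank_self i
  have hn : 0 < n := i.pos
  by_cases hj : j = i <;> by_cases hk : k = i
  · rw [hj, hk]
  · have := (I.rank_bijOn i).mapsTo (show k ∈ {j | j ≠ i} from hk)
    rw [Set.mem_Icc] at this
    subst hj
    omega
  · have := (I.rank_bijOn i).mapsTo (show j ∈ {j | j ≠ i} from hj)
    rw [Set.mem_Icc] at this
    subst hk
    omega
  · exact (I.rank_bijOn i).injOn hj hk h

theorem SRInstance.rank_le (I : SRInstance n) (i j : Fin n) : I.rank i j ≤ n := by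
  by_cases hj : j = i
  · exact hj ▸ (I.rank_self j).le
  · have := ((I.rank_bijOn i).mapsTo (show j ∈ {j | j ≠ i} from hj)).2
    omega

theorem SRInstance.ne_of_rank_lt (I : SRInstance n) {i j k : Fin n}
    (h : I.rank i j < I.rank i k) : j ≠ i := by
  rintro rfl
  have := I.rank_le j k
  rw [I.rank_self] at h
  omega

/-- The stable matching partner of an agent who strictly prefers that partner to its predecessor,
but whose partner is not its successor, strictly prefers its own predecessor to the agent. -/
theorem rank_predecessor_lt_of_partner {I : SRInstance n} {M : Fin n → Fin n}
    {σ : Equiv.Perm (Fin n)} (hM : IsMatching M) (hσ : IsStablePartition I σ) {a : Fin n}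
    (hp : I.rank a (M a) < I.rank a (σ⁻¹ a)) (hs : M a ≠ σ a) :
    I.rank (M a) (σ⁻¹ (M a)) < I.rank (M a) (M (M a)) := by
  have hne := I.ne_of_rank_lt hp
  have hle : ¬ I.rank (M a) a < I.rank (M a) (σ⁻¹ (M a)) :=
    fun h => hσ.2 ⟨a, M a, hne.symm, hp, h⟩
  rw [hM a]
  refine lt_of_le_of_ne (not_lt.1 hle) fun h => hs ?_
  rw [← Equiv.Perm.inv_eq_iff_eq]
  exact I.rank_injective _ h

/-- The predecessor of an agent who strictly prefers its predecessor to its stable matching partner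
strictly prefers its own partner to that agent. -/
theorem rank_partner_lt_of_predecessor {I : SRInstance n} {M : Fin n → Fin n}
    {σ : Equiv.Perm (Fin n)} (hM : IsStableMatching I M) {b : Fin n}
    (hb : I.rank b (σ⁻¹ b) < I.rank b (M b)) :
    I.rank (σ⁻¹ b) (M (σ⁻¹ b)) < I.rank (σ⁻¹ b) b := by
  have hne := I.ne_of_rank_lt hb
  have hle : ¬ I.rank (σ⁻¹ b) b < I.rank (σ⁻¹ b) (M (σ⁻¹ b)) :=
    fun h => hM.2 (σ⁻¹ b) b ⟨hne, Or.inr h, Or.inr hb⟩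
  refine lt_of_le_of_ne (not_lt.1 hle) fun h => hb.ne ?_
  have hMb := hM.1 (σ⁻¹ b)
  rw [I.rank_injective _ h] at hMb
  rw [hMb]

/-- Relative to a stable matching, no agent ranks its partner strictly between its successor and
its predecessor, and the successor of an agent who prefers its partner to its successor prefers
its predecessor to its partner. -/
theorem IsStablePartition.partner_cases {I : SRInstance n} {M : Fin n → Fin n}
    {σ : Equiv.Perm (Fin n)} (hM : IsStableMatching I M) (hσ : IsStablePartition I σ) :
    (∀ a, I.rank a (M a) ≤ I.rank a (σ a) ∨ I.rank a (σ⁻¹ a) ≤ I.rank a (M a)) ∧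
    ∀ a, I.rank a (M a) < I.rank a (σ a) → I.rank (σ a) a < I.rank (σ a) (M (σ a)) := by
  classical
  let G : Finset (Fin n) := {a | I.rank a (M a) < I.rank a (σ a)}
  let N : Finset (Fin n) := {a | I.rank a (M a) < I.rank a (σ⁻¹ a) ∧ M a ≠ σ a}
  let B : Finset (Fin n) := {a | I.rank a (σ⁻¹ a) < I.rank a (M a)}
  have hGN : G ⊆ N := by
    intro a ha
    have ha : I.rank a (M a) < I.rank a (σ a) := by simpa [G] using ha
    have := hσ.1 a
    simp only [N, Finset.mem_filter_univ]
    exact ⟨by omega, fun h => by rw [h] at ha; omega⟩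
  have hNB : N.card ≤ B.card := by
    refine Finset.card_le_card_of_injOn M (fun a ha => ?_)
      (Function.LeftInverse.injective hM.1).injOn
    have ha : I.rank a (M a) < I.rank a (σ⁻¹ a) ∧ M a ≠ σ a := by simpa [N] using ha
    simpa [B] using rank_predecessor_lt_of_partner hM.1 hσ ha.1 ha.2
  have hBG : B.image ⇑σ⁻¹ ⊆ G := by
    intro a ha
    obtain ⟨b, hb, rfl⟩ := Finset.mem_image.1 ha
    have hb : I.rank b (σ⁻¹ b) < I.rank b (M b) := by simpa [B] using hb
    simpa [G] using rank_partner_lt_of_predecessor hM hb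
  have hcard : (B.image ⇑σ⁻¹).card = B.card := Finset.card_image_of_injective _ σ⁻¹.injective
  have hle := Finset.card_le_card hGN
  have hEqN : G = N := by
    have := Finset.card_le_card hBG
    exact Finset.eq_of_subset_of_card_le hGN (by omega)
  have hEqB : B.image ⇑σ⁻¹ = G := Finset.eq_of_subset_of_card_le hBG (by omega)
  refine ⟨fun a => ?_, fun a ha => ?_⟩
  · by_contra! h
    have ha : a ∈ N := by
      simp only [N, Finset.mem_filter_univ]
      exact ⟨h.2, fun e => by rw [e] at h; omega⟩
    rw [← hEqN] at ha
    have ha : I.rank a (M a) < I.rank a (σ a) := by simpa [G] using ha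
    omega
  · have haG : a ∈ G := by simpa [G] using ha
    rw [← hEqB] at haG
    obtain ⟨b, hb, rfl⟩ := Finset.mem_image.1 haG
    simpa [B] using hb

/-- Along cycles of length at least three, the agents who weakly prefer their stable matching
partner to their successor alternate with those who do not. -/
theorem IsStablePartition.alternates {I : SRInstance n} {M : Fin n → Fin n}
    {σ : Equiv.Perm (Fin n)} (hM : IsStableMatching I M) (hσ : IsStablePartition I σ) {a : Fin n}
    (ha : σ (σ a) ≠ a) :
    I.rank (σ a) (M (σ a)) ≤ I.rank (σ a) (σ (σ a)) ↔ ¬ I.rank a (M a) ≤ I.rank a (σ a) := by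
  obtain ⟨hcases, hsucc⟩ := hσ.partner_cases hM
  have hinv : σ⁻¹ (σ a) = a := σ.symm_apply_apply a
  have hlt : I.rank (σ a) (σ (σ a)) < I.rank (σ a) a := by
    have := hσ.1 (σ a)
    rw [hinv] at this
    exact lt_of_le_of_ne this fun h => ha (I.rank_injective _ h)
  constructor
  · intro h hle
    rcases hle.lt_or_eq with h' | h'
    · have := hsucc a h'
      omega
    · have := hM.1 a
      rw [I.rank_injective _ h'] at this
      rw [this] at h
      omega
  · intro h
    refine (hcases (σ a)).resolve_right fun h' => h ?_
    rw [hinv] at h'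
    rcases h'.lt_or_eq with h'' | h''
    · have := rank_partner_lt_of_predecessor (σ := σ) hM (b := σ a) (by rwa [hinv])
      rw [hinv] at this
      exact this.le
    · have := hM.1 (σ a)
      rw [← I.rank_injective _ h''] at this
      rw [this]

theorem pow_card_orbitOf_apply (σ : Equiv.Perm (Fin n)) (a : Fin n) :
    (σ ^ (orbitOf σ a).card) a = a := by
  classical
  by_cases h : σ a = a
  · exact Equiv.Perm.pow_apply_eq_self_of_apply_eq_self h _
  · have : orbitOf σ a = (σ.cycleOf a).support := by
      ext b
      rw [Equiv.Perm.mem_support_cycleOf_iff' h]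
      simp [orbitOf]
    rw [this]
    simpa using
      (Equiv.Perm.pow_mod_card_support_cycleOf_self_apply σ (σ.cycleOf a).support.card a).symm

theorem orbitOf_eq_orbitOf_iff {σ : Equiv.Perm (Fin n)} {a b : Fin n} :
    orbitOf σ a = orbitOf σ b ↔ σ.SameCycle a b := by
  constructor
  · intro h
    have : b ∈ orbitOf σ a := h ▸ by simp [orbitOf, Equiv.Perm.SameCycle.refl]
    simpa [orbitOf] using this
  · intro h
    ext c
    simpa [orbitOf] using ⟨h.symm.trans, h.trans⟩

theorem odd_oddCycleCount_iff (σ : Equiv.Perm (Fin n)) : Odd (oddCycleCount σ) ↔ Odd n := by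
  have hsum : n = ∑ s ∈ Finset.univ.image (fun a => orbitOf σ a), s.card := by
    conv_lhs => rw [← Fintype.card_fin n, ← Finset.card_univ,
      Finset.card_eq_sum_card_image (fun a => orbitOf σ a)]
    refine Finset.sum_congr rfl fun s hs => congrArg Finset.card ?_
    obtain ⟨a, -, rfl⟩ := Finset.mem_image.1 hs
    ext b
    rw [Finset.mem_filter_univ, orbitOf_eq_orbitOf_iff, Equiv.Perm.sameCycle_comm]
    simp [orbitOf]
  conv_rhs => rw [hsum, Finset.odd_sum_iff_odd_card_odd]
  rfl

/-- In a solvable instance every odd cycle of a stable partition is a fixed point. -/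
theorem IsStablePartition.apply_eq_of_odd_orbit {I : SRInstance n} (hsolv : Solvable I)
    {σ : Equiv.Perm (Fin n)} (hσ : IsStablePartition I σ) {a : Fin n}
    (hodd : Odd (orbitOf σ a).card) : σ a = a := by
  obtain ⟨M, hM⟩ := hsolv
  have hpow := pow_card_orbitOf_apply σ a
  by_contra hne
  have htwo : σ (σ a) ≠ a := by
    intro h
    obtain ⟨k, hk⟩ := hodd
    have hsq : (σ ^ 2) a = a := by simpa [sq] using h
    rw [hk, pow_succ', pow_mul, Equiv.Perm.mul_apply,
      Equiv.Perm.pow_apply_eq_self_of_apply_eq_self hsq] at hpow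
    exact hne hpow
  have halt : ∀ k : ℕ, I.rank ((σ ^ k) a) (M ((σ ^ k) a)) ≤ I.rank ((σ ^ k) a) (σ ((σ ^ k) a)) ↔
      (Even k ↔ I.rank a (M a) ≤ I.rank a (σ a)) := by
    intro k
    induction k with
    | zero => simp
    | succ k ih =>
      have hk : σ (σ ((σ ^ k) a)) ≠ (σ ^ k) a := by
        intro h
        refine htwo ((σ ^ k).injective ?_)
        rw [← h]
        simp only [← Equiv.Perm.mul_apply, ← pow_succ']
        simp only [pow_succ, mul_assoc]
      rw [pow_succ', Equiv.Perm.mul_apply, hσ.alternates hM hk, ih, Nat.even_add_one]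
      tauto
  have := halt (orbitOf σ a).card
  rw [hpow] at this
  have := Nat.not_even_iff_odd.2 hodd
  tauto

/-- A stable partition has at most one fixed point. -/
theorem IsStablePartition.fixed_unique {I : SRInstance n} {σ : Equiv.Perm (Fin n)}
    (hσ : IsStablePartition I σ) {a b : Fin n} (ha : σ a = a) (hb : σ b = b) : a = b := by
  by_contra hne
  have hlt : ∀ i j : Fin n, σ i = i → i ≠ j → I.rank i j < I.rank i (σ⁻¹ i) := by
    intro i j hi hij
    rw [Equiv.Perm.inv_eq_iff_eq.2 hi.symm, I.rank_self]
    exact lt_of_le_of_ne (I.rank_le i j) fun h =>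
      hij (I.rank_injective i (h.trans (I.rank_self i).symm)).symm
  exact hσ.2 ⟨a, b, hne, hlt a b ha hne, hlt b a hb (Ne.symm hne)⟩

theorem IsStablePartition.oddCycleCount_le_one {I : SRInstance n} (hsolv : Solvable I)
    {σ : Equiv.Perm (Fin n)} (hσ : IsStablePartition I σ) : oddCycleCount σ ≤ 1 := by
  refine Finset.card_le_one.2 fun s hs t ht => ?_
  rw [Finset.mem_filter, Finset.mem_image] at hs ht
  obtain ⟨⟨a, -, rfl⟩, ha⟩ := hs
  obtain ⟨⟨b, -, rfl⟩, hb⟩ := ht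
  rw [hσ.fixed_unique (hσ.apply_eq_of_odd_orbit hsolv ha) (hσ.apply_eq_of_odd_orbit hsolv hb)]

/-- If an SR instance with `n ≥ 2` agents is solvable, then every
stable partition has exactly 0 odd cycles when `n` is even, and exactly 1 odd
cycle, which is a fixed point, when `n` is odd. -/
theorem solvable_stable_partition_odd_cycles {n : ℕ} (hn : 2 ≤ n) (I : SRInstance n)
    (hsolv : Solvable I) (σ : Equiv.Perm (Fin n)) (hσ : IsStablePartition I σ) :
    (Even n → oddCycleCount σ = 0) ∧
    (Odd n → oddCycleCount σ = 1 ∧ ∀ a : Fin n, Odd (orbitOf σ a).card → σ a = a) := by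
  have hle := hσ.oddCycleCount_le_one hsolv
  have hpar := odd_oddCycleCount_iff σ
  refine ⟨fun hev => ?_, fun hodd => ⟨?_, fun a => hσ.apply_eq_of_odd_orbit hsolv⟩⟩
  · have := Nat.not_odd_iff_even.1 (hpar.not.2 (Nat.not_odd_iff_even.2 hev))
    obtain ⟨k, hk⟩ := this
    omega
  · obtain ⟨k, hk⟩ := hpar.2 hodd
    omega
end

section
/- For every n ≥ 2, there exists an SR instance with n agents that admits a stable partition containing exactly ⌊n/3⌋ + ((n mod 3) mod 2) cycles of odd length; hence the upper bound ⌊n/3⌋ + ((n mod 3) mod 2) on the number of odd cycles in a stable partition is tight for every n. -/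
variable {n : ℕ}

/-- A ranking of `Fin n` that places `i` last, `a` first and `b` among the first two. -/
theorem exists_perm_last_first_second (hn : 2 ≤ n) (i a b : Fin n) (ha : a ≠ i) (hb : b ≠ i) :
    ∃ e : Equiv.Perm (Fin n), (e i : ℕ) = n - 1 ∧ (e a : ℕ) = 0 ∧ (e b : ℕ) ≤ 1 := by
  obtain ⟨e, hei, hea⟩ : ∃ e : Equiv.Perm (Fin n), (e i : ℕ) = n - 1 ∧ (e a : ℕ) = 0 := by
    let e₀ : Equiv.Perm (Fin n) := Equiv.swap i ⟨n - 1, by omega⟩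
    refine ⟨e₀.trans (Equiv.swap (e₀ a) ⟨0, by omega⟩), ?_, by simp⟩
    have hi : e₀ i = ⟨n - 1, by omega⟩ := Equiv.swap_apply_left _ _
    have hne : e₀ i ≠ e₀ a := fun h => ha (e₀.injective h).symm
    rw [Equiv.trans_apply, Equiv.swap_apply_of_ne_of_ne hne, hi]
    rw [hi, Ne, Fin.mk.injEq]
    omega
  by_cases hab : b = a
  · exact ⟨e, hei, hea, by rw [hab]; omega⟩
  have hib : e i ≠ e b := fun h => hb (e.injective h).symm
  have hab' : e a ≠ e b := fun h => hab (e.injective h).symm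
  have hib' : (e i : ℕ) ≠ e b := fun h => hib (Fin.ext h)
  have hab'' : (e a : ℕ) ≠ e b := fun h => hab' (Fin.ext h)
  have hlt := (e b).isLt
  refine ⟨e.trans (Equiv.swap (e b) ⟨1, by omega⟩), ?_, ?_, by simp⟩
  · rw [Equiv.trans_apply, Equiv.swap_apply_of_ne_of_ne hib, hei]
    rw [Ne, Fin.ext_iff]
    change (e i : ℕ) ≠ 1
    omega
  · rw [Equiv.trans_apply, Equiv.swap_apply_of_ne_of_ne hab', hea]
    rw [Ne, Fin.ext_iff]
    change (e a : ℕ) ≠ 1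
    omega

/-- The instance whose preference lists are given by permutations placing each agent last
in its own list. -/
def SRInstance.ofPerm (hn : 2 ≤ n) (e : Fin n → Equiv.Perm (Fin n))
    (he : ∀ i, (e i i : ℕ) = n - 1) : SRInstance n where
  rank i j := e i j + 1
  rank_self i := by rw [he]; omega
  rank_bijOn i := by
    refine ⟨fun j hj => ?_, fun j _ k _ h => ?_, fun m hm => ?_⟩
    · have hne : (e i j : ℕ) ≠ e i i := fun h => hj ((e i).injective (Fin.ext h))
      have hlt := (e i j).isLt
      have hi := he i
      change 1 ≤ (e i j : ℕ) + 1 ∧ (e i j : ℕ) + 1 ≤ n - 1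
      omega
    · exact (e i).injective (Fin.ext (Nat.succ_injective h))
    · obtain ⟨h₁, h₂⟩ := hm
      refine ⟨(e i).symm ⟨m - 1, by omega⟩, ?_, ?_⟩
      · intro h
        have hi := he i
        rw [(Equiv.symm_apply_eq _).mp h |>.symm] at hi
        change m - 1 = n - 1 at hi
        omega
      · simp only [Equiv.apply_symm_apply]
        omega

/-- Every permutation with at most one fixed point is a stable partition of some instance. -/
theorem exists_isStablePartition (hn : 2 ≤ n) (σ : Equiv.Perm (Fin n))
    (hσ : ∀ i j, σ i = i → σ j = j → i = j) : ∃ I : SRInstance n, IsStablePartition I σ := by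
  have key : ∀ i, ∃ e : Equiv.Perm (Fin n), (e i : ℕ) = n - 1 ∧
      (σ i ≠ i → (e (σ i) : ℕ) = 0 ∧ (e (σ⁻¹ i) : ℕ) ≤ 1) := by
    intro i
    by_cases h : σ i = i
    · exact ⟨Equiv.swap i ⟨n - 1, by omega⟩, by simp, fun h' => absurd h h'⟩
    · obtain ⟨e, h₁, h₂, h₃⟩ := exists_perm_last_first_second hn i (σ i) (σ⁻¹ i) h
        (fun h' => h (Equiv.Perm.inv_eq_iff_eq.mp h').symm)
      exact ⟨e, h₁, fun _ => ⟨h₂, h₃⟩⟩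
  choose e he hfirst using key
  have top : ∀ i j, σ i ≠ i → (e i j : ℕ) + 1 < e i (σ⁻¹ i) + 1 → j = σ i := by
    intro i j hi hlt
    obtain ⟨h₀, h₁⟩ := hfirst i hi
    exact (e i).injective (Fin.ext (by omega))
  refine ⟨SRInstance.ofPerm hn e he, fun a => ?_, ?_⟩
  · change (e a (σ a) : ℕ) + 1 ≤ e a (σ⁻¹ a) + 1
    by_cases h : σ a = a
    · rw [h, Equiv.Perm.inv_eq_iff_eq.mpr h.symm]
    · have := (hfirst a h).1
      omega
  · rintro ⟨i, j, hij, h₁, h₂⟩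
    change (e i j : ℕ) + 1 < e i (σ⁻¹ i) + 1 at h₁
    change (e j i : ℕ) + 1 < e j (σ⁻¹ j) + 1 at h₂
    by_cases hi : σ i = i
    · by_cases hj : σ j = j
      · exact hij (hσ i j hi hj)
      · exact hij (σ.injective (hi.trans (top j i hj h₂)))
    · have hj := top i j hi h₁
      rw [Equiv.Perm.inv_eq_iff_eq.mpr hj] at h₂
      exact lt_irrefl _ h₂

/-- Rotation of each block of three consecutive agents, the last block being truncated. -/
noncomputable def tripleRotation (n : ℕ) : Equiv.Perm (Fin n) :=
  Equiv.ofBijective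
    (fun v : Fin n => (if h : v.val % 3 ≠ 2 ∧ v.val + 1 < n then ⟨v + 1, h.2⟩
      else ⟨v - v % 3, by omega⟩ : Fin n))
    (Finite.injective_iff_bijective.mp (by
      intro a b h
      have ha := a.isLt
      have hb := b.isLt
      ext
      dsimp only at h
      split_ifs at h <;> rw [Fin.mk.injEq] at h <;> omega))

theorem tripleRotation_val (v : Fin n) : (tripleRotation n v : ℕ) =
    if v.val % 3 ≠ 2 ∧ v.val + 1 < n then v.val + 1 else v - v % 3 := by
  simp only [tripleRotation, Equiv.ofBijective_apply]
  split_ifs <;> rfl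

theorem tripleRotation_val_div (v : Fin n) : (tripleRotation n v : ℕ) / 3 = v.val / 3 := by
  rw [tripleRotation_val]
  split_ifs <;> omega

theorem tripleRotation_fixed_unique (i j : Fin n) (hi : tripleRotation n i = i)
    (hj : tripleRotation n j = j) : i = j := by
  have hi' := tripleRotation_val i
  have hj' := tripleRotation_val j
  rw [hi] at hi'
  rw [hj] at hj'
  ext
  split_ifs at hi' hj' <;> omega

theorem sameCycle_tripleRotation_iff (a b : Fin n) :
    (tripleRotation n).SameCycle a b ↔ a.val / 3 = b.val / 3 := by
  constructor
  · intro h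
    obtain ⟨m, -, -, rfl⟩ := h.exists_pow_eq''
    clear h
    induction m with
    | zero => simp
    | succ k ih => rw [pow_succ', Equiv.Perm.mul_apply, tripleRotation_val_div, ← ih]
  · have base : ∀ v : Fin n, (tripleRotation n).SameCycle ⟨3 * (v.val / 3), by omega⟩ v := by
      intro v
      have hv := v.isLt
      have h3 : v.val % 3 = 0 ∨ v.val % 3 = 1 ∨ v.val % 3 = 2 := by omega
      rcases h3 with h | h | h
      · refine ⟨0, Fin.ext ?_⟩
        simp only [zpow_zero, Equiv.Perm.one_apply]
        omega
      · refine ⟨1, Fin.ext ?_⟩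
        simp only [zpow_one, tripleRotation_val]
        split_ifs <;> omega
      · refine ⟨2, Fin.ext ?_⟩
        rw [zpow_two, Equiv.Perm.mul_apply]
        simp only [tripleRotation_val]
        split_ifs <;> omega
    intro h
    have ha := base a
    simp only [h] at ha
    exact ha.symm.trans (base b)

/-- The agents of the `q`-th block of three consecutive agents. -/
def tripleBlock (n q : ℕ) : Finset (Fin n) :=
  Finset.univ.filter (fun b => b.val / 3 = q)

theorem card_tripleBlock (q : ℕ) : (tripleBlock n q).card = min (3 * q + 3) n - 3 * q := by
  rw [← Nat.card_Ico, ← Finset.card_map Fin.valEmbedding]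
  congr 1
  ext m
  simp only [tripleBlock, Finset.mem_map, Finset.mem_filter, Finset.mem_univ, true_and,
    Fin.valEmbedding_apply, Finset.mem_Ico]
  constructor
  · rintro ⟨b, hb, rfl⟩
    omega
  · intro h
    exact ⟨⟨m, by omega⟩, by simp only; omega, rfl⟩

theorem orbitOf_tripleRotation (a : Fin n) :
    orbitOf (tripleRotation n) a = tripleBlock n (a.val / 3) := by
  ext b
  simp [orbitOf, tripleBlock, sameCycle_tripleRotation_iff, eq_comm]

theorem oddCycleCount_tripleRotation (n : ℕ) :
    oddCycleCount (tripleRotation n) = n / 3 + (n % 3) % 2 := by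
  have himage : (Finset.univ.image (orbitOf (tripleRotation n))).filter (fun s => Odd s.card) =
      (Finset.range (n / 3 + (n % 3) % 2)).image (tripleBlock n) := by
    ext s
    simp only [Finset.mem_filter, Finset.mem_image, Finset.mem_univ, true_and, Finset.mem_range]
    constructor
    · rintro ⟨⟨a, rfl⟩, hodd⟩
      rw [orbitOf_tripleRotation, card_tripleBlock, Nat.odd_iff] at hodd
      exact ⟨a.val / 3, by omega, (orbitOf_tripleRotation a).symm⟩
    · rintro ⟨q, hq, rfl⟩
      refine ⟨⟨⟨3 * q, by omega⟩, ?_⟩, ?_⟩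
      · rw [orbitOf_tripleRotation]
        congr 1
        simp
      · rw [card_tripleBlock, Nat.odd_iff]
        omega
  have hinj : Set.InjOn (tripleBlock n) (Finset.range (n / 3 + (n % 3) % 2)) := by
    intro p hp q _ h
    rw [Finset.mem_coe, Finset.mem_range] at hp
    have hmem : (⟨3 * p, by omega⟩ : Fin n) ∈ tripleBlock n p := by simp [tripleBlock]
    rw [h] at hmem
    simpa [tripleBlock] using hmem
  rw [oddCycleCount, himage, Finset.card_image_of_injOn hinj, Finset.card_range]

/-- For every `n ≥ 2` there is an SR instance with `n` agents
admitting a stable partition with exactly `⌊n/3⌋ + ((n mod 3) mod 2)` odd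
cycles, so the upper bound on the number of odd cycles is tight. -/
theorem odd_cycle_upper_bound_tight (n : ℕ) (hn : 2 ≤ n) :
    ∃ (I : SRInstance n) (σ : Equiv.Perm (Fin n)),
      IsStablePartition I σ ∧ oddCycleCount σ = n / 3 + (n % 3) % 2 := by
  obtain ⟨I, hI⟩ := exists_isStablePartition hn (tripleRotation n) tripleRotation_fixed_unique
  exact ⟨I, tripleRotation n, hI, oddCycleCount_tripleRotation n⟩
end

section
/- Let I be an SR instance with n ≥ 2 agents and let RSC(I) denote the set of its reduced stable cycles. Then 1 ≤ |RSC(I)| ≤ n(n−1)/2 + 1. -/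
variable {n : ℕ}

theorem perm_apply_inv {α : Type*} (σ : Equiv.Perm α) (x : α) : σ (σ⁻¹ x) = x :=
  σ.apply_symm_apply x

theorem perm_inv_apply {α : Type*} (σ : Equiv.Perm α) (x : α) : σ⁻¹ (σ x) = x :=
  σ.symm_apply_apply x

namespace SRInstance

theorem rank_lt (I : SRInstance n) {i j : Fin n} (h : j ≠ i) : I.rank i j < n := by
  have h1 := (I.rank_bijOn i).mapsTo h
  have h2 := i.pos
  simp only [Set.mem_Icc] at h1
  omega

theorem rank_le_s16 (I : SRInstance n) (i j : Fin n) : I.rank i j ≤ n := by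
  by_cases h : j = i
  · rw [h, I.rank_self]
  · exact (I.rank_lt h).le

theorem rank_injective_s16 (I : SRInstance n) (i : Fin n) : Function.Injective (I.rank i) := by
  intro j k h
  by_cases hj : j = i <;> by_cases hk : k = i
  · rw [hj, hk]
  · have := I.rank_lt hk
    rw [← h, hj, I.rank_self] at this
    omega
  · have := I.rank_lt hj
    rw [h, hk, I.rank_self] at this
    omega
  · exact (I.rank_bijOn i).injOn hj hk h

theorem rank_lt_of_le_of_ne (I : SRInstance n) {i j k : Fin n} (h : I.rank i j ≤ I.rank i k)
    (hne : j ≠ k) : I.rank i j < I.rank i k :=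
  lt_of_le_of_ne h fun e => hne (I.rank_injective_s16 i e)

/-- `p` records, for every agent, the last entry of its list in a reduced preference table.
Agent `c` accepts `x` when it weakly prefers `x` to `p c`. Every agent is accepted by the last
entry of its own list, and an agent held by `b` finds `b` at least as good as anyone who
accepts it. -/
def IsTable (I : SRInstance n) (p : Fin n → Fin n) : Prop :=
  (∀ b, I.rank (p b) b ≤ I.rank (p b) (p (p b))) ∧
  ∀ b, p b ≠ b → ∀ c, I.rank c (p b) ≤ I.rank c (p c) → I.rank (p b) b ≤ I.rank (p b) c

theorem isTable_id (I : SRInstance n) : I.IsTable id :=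
  ⟨fun _ => le_rfl, fun _ h => absurd rfl h⟩

/-- A table in which no list can be shortened further. -/
def IsMinimalTable (I : SRInstance n) (p : Fin n → Fin n) : Prop :=
  I.IsTable p ∧ ∀ q, I.IsTable q → (∀ b, I.rank b (q b) ≤ I.rank b (p b)) → q = p

theorem exists_isMinimalTable (I : SRInstance n) : ∃ p, I.IsMinimalTable p := by
  obtain ⟨p, hp, hmin⟩ := Set.exists_min_image {p | I.IsTable p}
    (fun p => ∑ b, I.rank b (p b)) (Set.toFinite _) ⟨id, I.isTable_id⟩
  refine ⟨p, hp, fun q hq hle => ?_⟩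
  have h := (Finset.sum_eq_sum_iff_of_le fun b _ => hle b).1
    (le_antisymm (Finset.sum_le_sum fun b _ => hle b) (hmin q hq))
  exact funext fun b => I.rank_injective_s16 b (h b (Finset.mem_univ b))

/-- `σ a` is the best agent accepting `a`, where `c` accepts `a` when it weakly prefers `a` to
`σ⁻¹ c`. -/
def IsBestAccepting (I : SRInstance n) (σ : Equiv.Perm (Fin n)) : Prop :=
  ∀ a c, I.rank c a ≤ I.rank c (σ⁻¹ c) → I.rank a (σ a) ≤ I.rank a c

/-- A minimal table is the inverse of a permutation sending each agent to the best agent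
accepting it. -/
theorem exists_perm_isMinimalTable (I : SRInstance n) :
    ∃ σ : Equiv.Perm (Fin n), I.IsMinimalTable (σ⁻¹ : Equiv.Perm (Fin n)) ∧
      I.IsBestAccepting σ := by
  obtain ⟨p, hp⟩ := I.exists_isMinimalTable
  obtain ⟨⟨h1, h2⟩, hmin⟩ := hp
  have hs : ∀ a, ∃ b, I.rank b a ≤ I.rank b (p b) ∧
      ∀ c, I.rank c a ≤ I.rank c (p c) → I.rank a b ≤ I.rank a c := fun a =>
    Set.exists_min_image {b | I.rank b a ≤ I.rank b (p b)} (I.rank a) (Set.toFinite _)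
      ⟨p a, h1 a⟩
  choose s hs hsmin using hs
  have hps : ∀ a, p (s a) = a := by
    intro a
    have hba : I.rank a (s a) ≤ I.rank a (p a) := hsmin a _ (h1 a)
    have hle : ∀ b, I.rank b (Function.update p (s a) a b) ≤ I.rank b (p b) := by
      intro b
      by_cases hb : b = s a
      · subst hb
        simpa using hs a
      · simp [hb]
    have htab : I.IsTable (Function.update p (s a) a) := by
      constructor
      · intro x
        by_cases hx : x = s a
        · subst hx
          rw [Function.update_self]
          by_cases ha : a = s a
          · rw [← ha, Function.update_self]
          · rw [Function.update_of_ne ha]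
            exact hba
        · rw [Function.update_of_ne hx]
          by_cases hy : p x = s a
          · rw [hy, Function.update_self]
            have := h2 x (by rw [hy]; exact fun e => hx e.symm) a (by rw [hy]; exact hba)
            rwa [hy] at this
          · rw [Function.update_of_ne hy]
            exact h1 x
      · intro x hx c hc
        replace hc := hc.trans (hle c)
        by_cases hxa : x = s a
        · subst hxa
          rw [Function.update_self] at hc ⊢
          exact hsmin a c hc
        · rw [Function.update_of_ne hxa] at hx hc ⊢
          exact h2 x hx c hc
    have := congrFun (hmin _ htab hle) (s a)
    rw [Function.update_self] at this
    exact this.symm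
  have hsp : Function.LeftInverse s p := Function.LeftInverse.rightInverse_of_surjective hps
    (Finite.injective_iff_surjective.1 (Function.LeftInverse.injective hps))
  let σ : Equiv.Perm (Fin n) := ⟨s, p, hps, hsp⟩
  exact ⟨σ, ⟨⟨h1, h2⟩, hmin⟩, hsmin⟩

/-- `f a` is the best agent other than `σ a` accepting `a`, for every `a` whose successor and
predecessor differ. -/
def IsSecondBest (I : SRInstance n) (σ : Equiv.Perm (Fin n)) (f : Fin n → Fin n) : Prop :=
  ∀ a, σ a ≠ σ⁻¹ a → I.rank (f a) a ≤ I.rank (f a) (σ⁻¹ (f a)) ∧ f a ≠ σ a ∧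
    ∀ c, I.rank c a ≤ I.rank c (σ⁻¹ c) → c ≠ σ a → I.rank a (f a) ≤ I.rank a c

theorem IsMinimalTable.exists_isSecondBest {I : SRInstance n} {σ : Equiv.Perm (Fin n)}
    (hp : I.IsMinimalTable (σ⁻¹ : Equiv.Perm (Fin n))) : ∃ f, I.IsSecondBest σ f := by
  have : ∀ a, ∃ b, σ a ≠ σ⁻¹ a → I.rank b a ≤ I.rank b (σ⁻¹ b) ∧ b ≠ σ a ∧
      ∀ c, I.rank c a ≤ I.rank c (σ⁻¹ c) → c ≠ σ a → I.rank a b ≤ I.rank a c := by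
    intro a
    by_cases ha : σ a = σ⁻¹ a
    · exact ⟨a, fun h => absurd ha h⟩
    · obtain ⟨b, hb, hmin⟩ := Set.exists_min_image
        {b | I.rank b a ≤ I.rank b (σ⁻¹ b) ∧ b ≠ σ a} (I.rank a) (Set.toFinite _)
        ⟨σ⁻¹ a, hp.1.1 a, Ne.symm ha⟩
      exact ⟨b, fun _ => ⟨hb.1, hb.2, fun c h1 h2 => hmin c ⟨h1, h2⟩⟩⟩
  choose f hf using this
  exact ⟨f, hf⟩

theorem IsSecondBest.rank_le_pred {I : SRInstance n} {σ : Equiv.Perm (Fin n)} {f : Fin n → Fin n}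
    (hp : I.IsMinimalTable (σ⁻¹ : Equiv.Perm (Fin n))) (hf : I.IsSecondBest σ f) {a : Fin n}
    (ha : σ a ≠ σ⁻¹ a) : I.rank a (f a) ≤ I.rank a (σ⁻¹ a) :=
  (hf a ha).2.2 _ (hp.1.1 a) (Ne.symm ha)

theorem IsSecondBest.rank_lt {I : SRInstance n} {σ : Equiv.Perm (Fin n)} {f : Fin n → Fin n}
    (hf : I.IsSecondBest σ f) {a : Fin n} (ha : σ a ≠ σ⁻¹ a) :
    I.rank (f a) a < I.rank (f a) (σ⁻¹ (f a)) := by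
  refine I.rank_lt_of_le_of_ne (hf a ha).1 fun e => (hf a ha).2.1 ?_
  conv_rhs => rw [e]
  simp

/-- The predecessor of the second choice again has distinct successor and predecessor. -/
theorem IsSecondBest.next_ne {I : SRInstance n} {σ : Equiv.Perm (Fin n)} {f : Fin n → Fin n}
    (hp : I.IsMinimalTable (σ⁻¹ : Equiv.Perm (Fin n))) (hb : I.IsBestAccepting σ)
    (hf : I.IsSecondBest σ f) {a : Fin n} (ha : σ a ≠ σ⁻¹ a) :
    σ (σ⁻¹ (f a)) ≠ σ⁻¹ (σ⁻¹ (f a)) := by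
  intro e
  rw [perm_apply_inv, Equiv.Perm.eq_inv_iff_eq] at e
  have h1 := hf.rank_lt ha
  have h2 := hb (f a) a (hf.rank_le_pred hp ha)
  rw [e] at h2
  omega

/-- Eliminating a rotation from a minimal table must empty some list, which then consists of two
agents of the rotation. -/
theorem IsMinimalTable.exists_pair_of_rotation {I : SRInstance n} {σ : Equiv.Perm (Fin n)}
    {f : Fin n → Fin n} (hp : I.IsMinimalTable (σ⁻¹ : Equiv.Perm (Fin n)))
    (hb : I.IsBestAccepting σ) (hf : I.IsSecondBest σ f) {C : Set (Fin n)} (hC : C.Nonempty)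
    (hD : ∀ c ∈ C, σ c ≠ σ⁻¹ c) (hsurj : ∀ c ∈ C, ∃ e ∈ C, σ⁻¹ (f e) = c)
    (hinj : Set.InjOn f C) : ∃ d ∈ C, σ⁻¹ d ∈ C ∧ f d = σ⁻¹ d := by
  classical
  by_contra! hno
  have hq : ∀ b, ∃ a, (∀ c ∈ C, f c = b → a = c) ∧ ((∀ c ∈ C, f c ≠ b) → a = σ⁻¹ b) := by
    intro b
    by_cases h : ∃ c ∈ C, f c = b
    · obtain ⟨c, hc, rfl⟩ := h
      exact ⟨c, fun d hd e => hinj hc hd e.symm, fun h => absurd rfl (h c hc)⟩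
    · push Not at h
      exact ⟨σ⁻¹ b, fun c hc e => absurd e (h c hc), fun _ => rfl⟩
  choose q hq1 hq2 using hq
  have hqf : ∀ c ∈ C, q (f c) = c := fun c hc => hq1 _ c hc rfl
  have hle : ∀ b, I.rank b (q b) ≤ I.rank b (σ⁻¹ b) := by
    intro b
    by_cases h : ∃ c ∈ C, f c = b
    · obtain ⟨c, hc, rfl⟩ := h
      rw [hqf c hc]
      exact (hf c (hD c hc)).1
    · push Not at h
      rw [hq2 b h]
  have htab : I.IsTable q := by
    constructor
    · intro b
      by_cases h : ∃ c ∈ C, f c = b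
      · obtain ⟨c, hc, rfl⟩ := h
        rw [hqf c hc]
        by_cases h' : ∃ d ∈ C, f d = c
        · obtain ⟨d, hd, rfl⟩ := h'
          rw [hqf d hd]
          by_contra! hlt
          have hds : d = σ (f d) := by
            by_contra hne
            have := (hf _ (hD _ hc)).2.2 d (hf.rank_le_pred hp (hD d hd)) hne
            omega
          have hpd : f d = σ⁻¹ d := by rw [Equiv.Perm.eq_inv_iff_eq, ← hds]
          exact hno d hd (hpd ▸ hc) hpd
        · push Not at h'
          rw [hq2 c h']
          exact hf.rank_le_pred hp (hD c hc)
      · push Not at h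
        rw [hq2 b h]
        by_cases h' : ∃ d ∈ C, f d = σ⁻¹ b
        · obtain ⟨d, hd, hdb⟩ := h'
          have h3 := hb (f d) d (hf.rank_le_pred hp (hD d hd))
          rw [← hdb, hqf d hd]
          rwa [show σ (f d) = b by rw [hdb]; simp] at h3
        · push Not at h'
          rw [hq2 _ h']
          exact hp.1.1 b
    · intro b hbq d hd
      have hd' := hd.trans (hle d)
      by_cases h : ∃ c ∈ C, f c = b
      · obtain ⟨c, hc, rfl⟩ := h
        rw [hqf c hc] at hd hd' ⊢
        refine (hf c (hD c hc)).2.2 d hd' ?_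
        rintro rfl
        obtain ⟨e, he, hec⟩ := hsurj c hc
        have hfe : f e = σ c := by rw [← hec]; simp
        have h3 := hf.rank_lt (hD e he)
        rw [hec, hfe] at h3
        have h4 := hqf e he
        rw [hfe] at h4
        rw [h4] at hd
        omega
      · push Not at h
        rw [hq2 b h] at hbq hd' ⊢
        exact hp.1.2 b hbq d hd'
  obtain ⟨c, hc⟩ := hC
  have h5 := congrFun (hp.2 q htab hle) (f c)
  have h6 := hf.rank_lt (hD c hc)
  rw [← h5, hqf c hc] at h6
  omega

/-- In a minimal table, every list whose ends differ has only two entries, and all cycles of the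
permutation through such agents are traversed by the square of the inverse. -/
theorem IsMinimalTable.list_eq_pair {I : SRInstance n} {σ : Equiv.Perm (Fin n)}
    (hp : I.IsMinimalTable (σ⁻¹ : Equiv.Perm (Fin n))) (hb : I.IsBestAccepting σ) {x : Fin n}
    (hx : σ x ≠ σ⁻¹ x) :
    (∀ c, I.rank c x ≤ I.rank c (σ⁻¹ c) → c ≠ σ x → I.rank x (σ⁻¹ x) ≤ I.rank x c) ∧
      ∃ k : ℕ, σ⁻¹ x = (σ⁻¹ ^ (2 * k)) x := by
  obtain ⟨f, hf⟩ := hp.exists_isSecondBest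
  set ν : Fin n → Fin n := fun a => σ⁻¹ (f a) with hν
  have hDν : ∀ k, σ (ν^[k] x) ≠ σ⁻¹ (ν^[k] x) := by
    intro k
    induction k with
    | zero => exact hx
    | succ k ih =>
      rw [Function.iterate_succ_apply']
      exact hf.next_ne hp hb ih
  obtain ⟨i, m, hm, hper⟩ : ∃ i m, 0 < m ∧ ν^[m] (ν^[i] x) = ν^[i] x := by
    obtain ⟨i, j, hij, h⟩ := Finite.exists_ne_map_eq_of_infinite fun k => ν^[k] x
    rcases lt_or_gt_of_ne hij with hlt | hlt
    · refine ⟨i, j - i, by omega, ?_⟩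
      rw [← Function.iterate_add_apply, Nat.sub_add_cancel hlt.le]
      exact h.symm
    · refine ⟨j, i - j, by omega, ?_⟩
      rw [← Function.iterate_add_apply, Nat.sub_add_cancel hlt.le]
      exact h
  set y := ν^[i] x with hy
  set C : Set (Fin n) := {c | ∃ k, ν^[k] y = c}
  have hyC : y ∈ C := ⟨0, rfl⟩
  have hCper : ∀ c ∈ C, ν^[m] c = c := by
    rintro _ ⟨k, rfl⟩
    rw [← Function.iterate_add_apply, add_comm, Function.iterate_add_apply, hper]
  have hCiter : ∀ c ∈ C, ∀ k, ν^[k] c ∈ C := by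
    rintro _ ⟨j, rfl⟩ k
    exact ⟨k + j, Function.iterate_add_apply ν k j y⟩
  have hCback : ∀ c ∈ C, ∃ e ∈ C, ν e = c := by
    intro c hc
    refine ⟨ν^[m - 1] c, hCiter c hc _, ?_⟩
    rw [← Function.iterate_succ_apply' ν, Nat.succ_eq_add_one, Nat.sub_add_cancel hm, hCper c hc]
  have hCtrans : ∀ c ∈ C, ∀ d ∈ C, ∃ k, ν^[k] c = d := by
    rintro _ ⟨j, rfl⟩ _ ⟨k, rfl⟩
    refine ⟨k + (m * j - j), ?_⟩
    rw [← Function.iterate_add_apply,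
      show k + (m * j - j) + j = k + m * j by have := Nat.le_mul_of_pos_left j hm; omega,
      Function.iterate_add_apply, Function.iterate_mul, Function.iterate_fixed hper]
  have hCD : ∀ c ∈ C, σ c ≠ σ⁻¹ c := by
    rintro _ ⟨k, rfl⟩
    rw [hy, ← Function.iterate_add_apply]
    exact hDν _
  have hCinj : Set.InjOn f C := by
    intro c hc d hd e
    have h1 : ν^[m] c = ν^[m] d := by
      rw [← Nat.sub_add_cancel hm, Function.iterate_succ_apply, Function.iterate_succ_apply]
      simp only [hν, e]
    rwa [hCper c hc, hCper d hd] at h1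
  obtain ⟨d, hdC, hdpC, hdf⟩ := hp.exists_pair_of_rotation hb hf ⟨y, hyC⟩ hCD hCback hCinj
  have hsucc : ∀ d, (d ∈ C ∧ σ⁻¹ d ∈ C ∧ f d = σ⁻¹ d) →
      (σ d ∈ C ∧ σ⁻¹ (σ d) ∈ C ∧ f (σ d) = σ⁻¹ (σ d)) := by
    rintro d ⟨hd, hpd, hfd⟩
    obtain ⟨e, he, hea⟩ := hCback _ hpd
    have hfe : f e = d := σ⁻¹.injective hea
    have hes : e = σ d := by
      by_contra hne
      have h1 := (hf d (hCD d hd)).2.2 e (hfe ▸ hf.rank_le_pred hp (hCD e he)) hne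
      have h2 := hf.rank_lt (hCD e he)
      rw [hfe] at h2
      rw [hfd] at h1
      omega
    subst hes
    rw [perm_inv_apply]
    exact ⟨he, hd, hfe⟩
  have hgood_pow : ∀ (k : ℕ) d, (d ∈ C ∧ σ⁻¹ d ∈ C ∧ f d = σ⁻¹ d) →
      ((σ ^ k) d ∈ C ∧ σ⁻¹ ((σ ^ k) d) ∈ C ∧ f ((σ ^ k) d) = σ⁻¹ ((σ ^ k) d)) := by
    intro k d hd
    induction k with
    | zero => exact hd
    | succ k ih =>
      rw [pow_succ', Equiv.Perm.mul_apply]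
      exact hsucc _ ih
  have hpred : ∀ d, (d ∈ C ∧ σ⁻¹ d ∈ C ∧ f d = σ⁻¹ d) →
      (σ⁻¹ d ∈ C ∧ σ⁻¹ (σ⁻¹ d) ∈ C ∧ f (σ⁻¹ d) = σ⁻¹ (σ⁻¹ d)) := by
    intro d hd
    have hinv : σ⁻¹ = σ ^ (orderOf σ - 1) := by
      rw [inv_eq_iff_mul_eq_one, ← pow_succ', Nat.sub_add_cancel (orderOf_pos σ), pow_orderOf_eq_one]
    have := hgood_pow (orderOf σ - 1) d hd
    rwa [← hinv] at this
  have hiter : ∀ k, (ν^[k] d ∈ C ∧ σ⁻¹ (ν^[k] d) ∈ C ∧ f (ν^[k] d) = σ⁻¹ (ν^[k] d)) := by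
    intro k
    induction k with
    | zero => exact ⟨hdC, hdpC, hdf⟩
    | succ k ih =>
      rw [Function.iterate_succ_apply']
      have h1 : ν (ν^[k] d) = σ⁻¹ (σ⁻¹ (ν^[k] d)) := by
        rw [← ih.2.2]
      rw [h1]
      exact hpred _ (hpred _ ih)
  have hgood : ∀ c ∈ C, σ⁻¹ c ∈ C ∧ f c = σ⁻¹ c := by
    intro c hc
    obtain ⟨k, rfl⟩ := hCtrans d hdC c hc
    exact (hiter k).2
  have hback : ∀ a, σ a ≠ σ⁻¹ a → ν a ∈ C → a ∈ C := by
    intro a ha hc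
    have hgs := hsucc _ ⟨hc, hgood _ hc⟩
    rw [show σ (ν a) = f a by simp [hν]] at hgs
    have has : a = σ (f a) := by
      by_contra hne
      have h1 := (hf _ (hCD _ hgs.1)).2.2 a (hf.rank_le_pred hp ha) hne
      have h2 := hf.rank_lt ha
      rw [hgs.2.2] at h1
      omega
    rw [has]
    exact (hsucc _ ⟨hgs.1, hgood _ hgs.1⟩).1
  have hxC : x ∈ C := by
    have : ∀ j, j ≤ i → ν^[i - j] x ∈ C := by
      intro j
      induction j with
      | zero => exact fun _ => hyC
      | succ j ih =>
        intro hj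
        refine hback _ (hDν _) ?_
        rw [← Function.iterate_succ_apply' ν, show (i - (j + 1)).succ = i - j by omega]
        exact ih (by omega)
    simpa using this i le_rfl
  refine ⟨fun c h1 h2 => ?_, ?_⟩
  · have := (hf x hx).2.2 c h1 h2
    rwa [(hgood x hxC).2] at this
  · obtain ⟨k, hk⟩ := hCtrans x hxC _ (hgood x hxC).1
    refine ⟨k, ?_⟩
    rw [← hk]
    clear hk
    induction k with
    | zero => rfl
    | succ k ih =>
      have h3 := (hgood _ (hCiter x hxC k)).2
      rw [Function.iterate_succ_apply', show 2 * (k + 1) = 2 * k + 1 + 1 by ring, pow_succ',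
        pow_succ', Equiv.Perm.mul_apply, Equiv.Perm.mul_apply, ← ih, ← h3]

/-- A minimal table yields a stable partition. -/
theorem IsMinimalTable.isStablePartition {I : SRInstance n} {σ : Equiv.Perm (Fin n)}
    (hp : I.IsMinimalTable (σ⁻¹ : Equiv.Perm (Fin n))) (hb : I.IsBestAccepting σ) :
    IsStablePartition I σ := by
  refine ⟨fun a => hb a _ (hp.1.1 a), ?_⟩
  rintro ⟨i, j, -, hi, hj⟩
  have h1 := hb i j hj.le
  have hne : σ i ≠ σ⁻¹ i := fun e => by rw [e] at h1; omega
  by_cases hji : j = σ i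
  · subst hji
    simp at hj
  · have := (hp.list_eq_pair hb hne).1 j hj.le hji
    omega

theorem card_lt_add_card_gt (I : SRInstance n) (u v : Fin n → Fin n) :
    (Finset.univ.filter fun i => I.rank i (u i) < I.rank i (v i)).card +
      (Finset.univ.filter fun i => I.rank i (v i) < I.rank i (u i)).card =
      (Finset.univ.filter fun i => u i ≠ v i).card := by
  rw [← Finset.card_union_of_disjoint]
  · congr 1
    ext i
    simp only [Finset.mem_union, Finset.mem_filter, Finset.mem_univ, true_and]
    rw [← lt_or_lt_iff_ne.trans (I.rank_injective_s16 i).ne_iff]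
  · rw [Finset.disjoint_filter]
    intro i _ h
    exact h.asymm

end SRInstance

section StablePartition

variable {I : SRInstance n} {σ τ : Equiv.Perm (Fin n)}

theorem IsStablePartition.rank_pred_le (hσ : IsStablePartition I σ) {i j : Fin n}
    (h : I.rank i j < I.rank i (σ⁻¹ i)) : I.rank j (σ⁻¹ j) ≤ I.rank j i := by
  by_contra! hlt
  refine hσ.2 ⟨i, j, ?_, h, hlt⟩
  rintro rfl
  rw [I.rank_self] at h
  exact h.not_ge (I.rank_le_s16 _ _)

/-- If `i` is better off with its successor in `σ` than in `τ`, then that successor has a better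
predecessor in `τ` than in `σ`. -/
theorem IsStablePartition.rank_pred_lt_of_rank_succ_lt (hτ : IsStablePartition I τ) {i : Fin n}
    (h : I.rank i (σ i) < I.rank i (τ i)) :
    I.rank (σ i) (τ⁻¹ (σ i)) < I.rank (σ i) i := by
  refine I.rank_lt_of_le_of_ne (hτ.rank_pred_le (h.trans_le (hτ.1 i))) fun e => ?_
  rw [Equiv.Perm.inv_eq_iff_eq] at e
  rw [e] at h
  exact h.false

theorem IsStablePartition.rank_succ_lt_of_rank_pred_lt (hσ : IsStablePartition I σ)
    (hτ : IsStablePartition I τ) {j : Fin n} (h : I.rank j (τ⁻¹ j) < I.rank j (σ⁻¹ j)) :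
    I.rank (σ⁻¹ j) j < I.rank (σ⁻¹ j) (τ (σ⁻¹ j)) := by
  set S := Finset.univ.filter fun i => I.rank i (σ i) < I.rank i (τ i)
  set T := Finset.univ.filter fun i => I.rank i (τ i) < I.rank i (σ i)
  set Q := Finset.univ.filter fun j => I.rank j (τ⁻¹ j) < I.rank j (σ⁻¹ j)
  set P := Finset.univ.filter fun j => I.rank j (σ⁻¹ j) < I.rank j (τ⁻¹ j)
  have hST : S.card + T.card = _ := I.card_lt_add_card_gt σ τ
  have hQP : Q.card + P.card = _ := I.card_lt_add_card_gt (τ⁻¹ : Equiv.Perm (Fin n))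
    (σ⁻¹ : Equiv.Perm (Fin n))
  have hN : (Finset.univ.filter fun i => σ i ≠ τ i).image σ =
      Finset.univ.filter fun j => τ⁻¹ j ≠ σ⁻¹ j := by
    ext j
    simp only [Finset.mem_image, Finset.mem_filter, Finset.mem_univ, true_and]
    constructor
    · rintro ⟨i, hi, rfl⟩ e
      rw [Equiv.Perm.inv_eq_iff_eq] at e
      apply hi
      rw [e]
      congr 1
      exact σ.symm_apply_apply i
    · intro hj
      refine ⟨σ⁻¹ j, fun e => hj ?_, perm_apply_inv σ j⟩
      rw [Equiv.Perm.inv_eq_iff_eq, ← e, perm_apply_inv]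
  have hN' := congrArg Finset.card hN
  rw [Finset.card_image_of_injective _ σ.injective] at hN'
  have hSQ : S.image σ ⊆ Q := by
    intro j hj
    simp only [S, Finset.mem_image, Finset.mem_filter, Finset.mem_univ, true_and] at hj
    obtain ⟨i, hi, rfl⟩ := hj
    have := hτ.rank_pred_lt_of_rank_succ_lt hi
    simpa [Q] using this
  have hTP : T.image τ ⊆ P := by
    intro j hj
    simp only [T, Finset.mem_image, Finset.mem_filter, Finset.mem_univ, true_and] at hj
    obtain ⟨i, hi, rfl⟩ := hj
    have := hσ.rank_pred_lt_of_rank_succ_lt hi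
    simpa [P] using this
  have hTP' := Finset.card_le_card hTP
  rw [Finset.card_image_of_injective _ τ.injective] at hTP'
  have hS := Finset.card_image_of_injective S σ.injective
  have hEq : S.image σ = Q := Finset.eq_of_subset_of_card_le hSQ (by omega)
  have hj : j ∈ S.image σ := by
    rw [hEq]
    simpa [Q] using h
  obtain ⟨i, hi, rfl⟩ := Finset.mem_image.1 hj
  simpa [S] using hi

theorem IsStablePartition.rank_pred_lt_succ_of_rank_succ_lt (hσ : IsStablePartition I σ)
    (hτ : IsStablePartition I τ) {i : Fin n} (h : I.rank i (σ i) < I.rank i (τ i)) :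
    I.rank (τ i) i < I.rank (τ i) (σ⁻¹ (τ i)) := by
  have hi : τ⁻¹ (τ i) = i := τ.symm_apply_apply i
  rcases lt_trichotomy (I.rank (τ i) i) (I.rank (τ i) (σ⁻¹ (τ i))) with h1 | h1 | h1
  · exact h1
  · have := I.rank_injective_s16 _ h1
    rw [Equiv.Perm.eq_inv_iff_eq] at this
    rw [this] at h
    exact absurd h (lt_irrefl _)
  · have h2 := hτ.rank_succ_lt_of_rank_pred_lt hσ (j := τ i) (by rwa [hi])
    rw [hi] at h2
    exact absurd h h2.asymm

/-- Two stable partitions have the same predecessors on every odd cycle. -/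
theorem IsStablePartition.inv_apply_eq_of_odd (hσ : IsStablePartition I σ)
    (hτ : IsStablePartition I τ) {a : Fin n} (ha : Odd (Function.minimalPeriod σ a)) (m : ℕ) :
    τ⁻¹ ((σ ^ m) a) = σ⁻¹ ((σ ^ m) a) := by
  set x : ℕ → Fin n := fun k => (σ ^ k) a with hx
  have hsucc : ∀ k, σ (x k) = x (k + 1) := fun k => by
    simp only [hx]
    rw [pow_succ', Equiv.Perm.mul_apply]
  have hpred : ∀ k, σ⁻¹ (x (k + 1)) = x k := fun k => by
    rw [Equiv.Perm.inv_eq_iff_eq, hsucc]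
  have hper : ∀ k, x (k + Function.minimalPeriod σ a) = x k := fun k => by
    simp only [hx, pow_add, Equiv.Perm.mul_apply]
    rw [Equiv.Perm.coe_pow σ (Function.minimalPeriod σ a), Function.iterate_minimalPeriod]
  have hper' : ∀ k l, x (k + l * Function.minimalPeriod σ a) = x k := by
    intro k l
    induction l with
    | zero => simp
    | succ l ih => rw [add_mul, one_mul, ← add_assoc, hper, ih]
  have hno2 : ∀ k, x (k + 2) = x k → x (k + 1) = x k := by
    intro k hk
    have h2 : ∀ l, x (k + 2 * l) = x k ∧ x (k + 2 * l + 1) = x (k + 1) := by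
      intro l
      induction l with
      | zero => simp
      | succ l ih =>
        have h3 : x (k + 2 * (l + 1)) = x k := by
          rw [show k + 2 * (l + 1) = k + 2 * l + 1 + 1 by ring, ← hsucc, ih.2, hsucc, hk]
        exact ⟨h3, by rw [← hsucc, h3, hsucc]⟩
    obtain ⟨l, hl⟩ := ha
    rw [← (h2 l).2, add_assoc, ← hl, hper]
  have hpos : 0 < Function.minimalPeriod σ a := ha.pos
  set Q : ℕ → Prop := fun k => I.rank (x k) (τ⁻¹ (x k)) < I.rank (x k) (σ⁻¹ (x k)) with hQ
  set P : ℕ → Prop := fun k => I.rank (x k) (σ⁻¹ (x k)) < I.rank (x k) (τ⁻¹ (x k)) with hP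
  set E : ℕ → Prop := fun k => τ⁻¹ (x k) = σ⁻¹ (x k) with hE
  have htri : ∀ k, P k ∨ E k ∨ Q k := by
    intro k
    rcases lt_trichotomy (I.rank (x k) (σ⁻¹ (x k))) (I.rank (x k) (τ⁻¹ (x k))) with h | h | h
    · exact Or.inl h
    · exact Or.inr (Or.inl (I.rank_injective_s16 _ h.symm))
    · exact Or.inr (Or.inr h)
  have hEQ : ∀ k, E k → ¬ Q k := by
    intro k h1 h2
    simp only [hE, hQ] at h1 h2
    rw [h1] at h2
    exact h2.false
  have hEP : ∀ k, E k → ¬ P k := by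
    intro k h1 h2
    simp only [hE, hP] at h1 h2
    rw [h1] at h2
    exact h2.false
  have hS : ∀ k, Q (k + 1) → I.rank (x k) (x (k + 1)) < I.rank (x k) (τ (x k)) := by
    intro k h
    have := hσ.rank_succ_lt_of_rank_pred_lt hτ h
    rwa [hpred] at this
  -- a better predecessor in `τ` is never followed by another one
  have hQQ : ∀ k, Q k → ¬ Q (k + 1) := by
    intro k h1 h2
    have h3 := hS k h2
    rw [← hsucc] at h3
    have h4 := hσ.rank_pred_lt_succ_of_rank_succ_lt hτ h3
    have h5 := hσ.rank_pred_le ((hτ.1 (x k)).trans_lt h1)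
    omega
  have hPs : ∀ k, P (k + 1) → I.rank (x k) (τ⁻¹ (x k)) ≤ I.rank (x k) (x (k + 1)) := by
    intro k h
    simp only [hP, hpred] at h
    exact hτ.rank_pred_le h
  have hPP : ∀ k, P k → ¬ P (k + 1) := by
    intro k h1 h2
    have h3 := hPs k h2
    have h4 := hσ.1 (x k)
    rw [hsucc] at h4
    simp only [hP] at h1
    omega
  have hEnP : ∀ k, E k → ¬ P (k + 1) := by
    intro k h1 h2
    have h3 := hPs k h2
    have h4 := hσ.1 (x k)
    have h6 : τ⁻¹ (x k) = σ⁻¹ (x k) := h1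
    rw [h6, ← hsucc] at h3
    have h5 := I.rank_injective_s16 _ (le_antisymm h4 h3)
    obtain ⟨l, hl⟩ : ∃ l, x (l + 1) = x k := by
      refine ⟨k + Function.minimalPeriod σ a - 1, ?_⟩
      rw [← hper k]
      congr 1
      omega
    have h7 : x (l + 2) = x l := by
      rw [← hsucc (l + 1), hl, h5, ← hl, hpred]
    have h8 := hno2 l h7
    have h9 : x (k + 1) = x k := by
      rw [← hsucc k, h5, ← hl, hpred, h8]
    have h10 : E (k + 1) := by
      simp only [hE, h9]
      exact h6
    exact hEP _ h10 h2
  have hEnQ : ∀ k, E (k + 1) → Q (k + 2) → Q k := by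
    intro k h1 h2
    have h3 := hS (k + 1) h2
    rw [show x (k + 1 + 1) = σ (x (k + 1)) from (hsucc _).symm] at h3
    have h4 := hσ.rank_pred_lt_succ_of_rank_succ_lt hτ h3
    have h1' : τ⁻¹ (x (k + 1)) = σ⁻¹ (x (k + 1)) := h1
    have h5 := hτ.1 (x (k + 1))
    have h7 : τ (x (k + 1)) = x k := by
      rw [← hpred k]
      rw [h1'] at h5
      by_contra hne
      have h6 := hσ.rank_pred_le (I.rank_lt_of_le_of_ne h5 hne)
      omega
    have h8 : τ⁻¹ (x k) = x (k + 1) := by rw [Equiv.Perm.inv_eq_iff_eq, h7]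
    simp only [hQ]
    rw [h8]
    rwa [h7] at h4
  have hEE : ∀ k, E (k + 1) → ¬ Q k → E (k + 2) := by
    intro k h1 h2
    rcases htri (k + 2) with h | h | h
    · exact absurd h (hEnP _ h1)
    · exact h
    · exact absurd (hEnQ k h1 h) h2
  by_contra hne
  have hnot : ∀ k, E (k + 1) → Q k := by
    intro k h1
    by_contra h2
    have hall : ∀ j, E (k + 1 + j) := by
      intro j
      have : E (k + 1 + j) ∧ ¬ Q (k + j) := by
        induction j with
        | zero => exact ⟨h1, h2⟩
        | succ j ih =>
          refine ⟨?_, ?_⟩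
          · rw [show k + 1 + (j + 1) = k + j + 2 by ring]
            exact hEE _ (by rw [show k + j + 1 = k + 1 + j by ring]; exact ih.1) ih.2
          · rw [show k + (j + 1) = k + 1 + j by ring]
            exact hEQ _ ih.1
      exact this.1
    apply hne
    have h3 := hall (m + (k + 1) * (Function.minimalPeriod σ a) - (k + 1))
    have h4 := Nat.le_mul_of_pos_right (k + 1) hpos
    rw [show k + 1 + (m + (k + 1) * (Function.minimalPeriod σ a) - (k + 1)) =
      m + (k + 1) * Function.minimalPeriod σ a by omega] at h3
    simp only [hE, hper'] at h3
    exact h3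
  have halt : ∀ k, Q (k + 2) ↔ ¬ Q (k + 1) := by
    intro k
    refine ⟨fun h1 h2 => hQQ _ h2 h1, fun h1 => ?_⟩
    rcases htri (k + 2) with h | h | h
    · rcases htri (k + 1) with h' | h' | h'
      · exact absurd h (hPP _ h')
      · exact absurd h (hEnP _ h')
      · exact absurd h' h1
    · exact absurd (hnot _ h) h1
    · exact h
  have hpar : ∀ k, Q (k + 1) ↔ (Q 1 ↔ Even k) := by
    intro k
    induction k with
    | zero => simp
    | succ k ih =>
      rw [halt, ih, Nat.even_add_one]
      tauto
  have h1 := hpar (Function.minimalPeriod σ a)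
  have h2 : Q (Function.minimalPeriod σ a + 1) ↔ Q 1 := by
    simp only [hQ]
    rw [add_comm, hper]
  have h3 : ¬ Even (Function.minimalPeriod σ a) := Nat.not_even_iff_odd.2 ha
  tauto

end StablePartition

theorem mem_orbitOf {σ : Equiv.Perm (Fin n)} {a b : Fin n} :
    b ∈ orbitOf σ a ↔ σ.SameCycle a b := by
  simp [orbitOf]

theorem card_orbitOf (σ : Equiv.Perm (Fin n)) (a : Fin n) :
    (orbitOf σ a).card = Function.minimalPeriod σ a := by
  classical
  have h := MulAction.minimalPeriod_eq_card σ a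
  refine Eq.trans ?_ h.symm
  symm
  apply Fintype.card_of_subtype
  intro b
  rw [mem_orbitOf]
  constructor
  · rintro ⟨k, hk⟩
    exact ⟨⟨σ ^ k, k, rfl⟩, hk⟩
  · rintro ⟨⟨_, k, rfl⟩, hk⟩
    exact ⟨k, hk⟩

theorem zpow_apply_eq_iff_minimalPeriod_dvd (σ : Equiv.Perm (Fin n)) (a : Fin n) (k : ℤ) :
    (σ ^ k) a = a ↔ (Function.minimalPeriod σ a : ℤ) ∣ k :=
  MulAction.zpow_smul_eq_iff_minimalPeriod_dvd (a := σ) (b := a)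

theorem cycleAt_eq_of_sameCycle {σ : Equiv.Perm (Fin n)} {a b : Fin n} (h : σ.SameCycle a b) :
    cycleAt σ a = cycleAt σ b := by
  refine Prod.ext ?_ h.cycleOf_eq
  ext c
  exact mem_orbitOf.trans (Iff.trans ⟨h.symm.trans, h.trans⟩ mem_orbitOf.symm)

theorem cycleAt_congr {σ τ : Equiv.Perm (Fin n)} {a : Fin n}
    (h : ∀ k : ℕ, τ ((σ ^ k) a) = σ ((σ ^ k) a)) : cycleAt τ a = cycleAt σ a := by
  have hpow : ∀ k : ℕ, (τ ^ k) a = (σ ^ k) a := by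
    intro k
    induction k with
    | zero => rfl
    | succ k ih => rw [pow_succ', pow_succ', Equiv.Perm.mul_apply, Equiv.Perm.mul_apply, ih, h]
  have hsame : ∀ b, τ.SameCycle a b ↔ σ.SameCycle a b := by
    intro b
    constructor
    · intro hb
      obtain ⟨k, -, hk⟩ := hb.exists_pow_eq'
      exact ⟨k, by rw [zpow_natCast, ← hpow, hk]⟩
    · intro hb
      obtain ⟨k, -, hk⟩ := hb.exists_pow_eq'
      exact ⟨k, by rw [zpow_natCast, hpow, hk]⟩
  refine Prod.ext ?_ ?_
  · ext b
    exact mem_orbitOf.trans ((hsame b).trans mem_orbitOf.symm)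
  · ext b
    simp only [cycleAt, Equiv.Perm.cycleOf_apply, hsame]
    split_ifs with hb
    · obtain ⟨k, -, rfl⟩ := hb.exists_pow_eq'
      rw [h]
    · rfl

/-- An odd cycle of one stable partition is a cycle of every other. -/
theorem IsStablePartition.cycleAt_eq_of_odd {I : SRInstance n} {σ τ : Equiv.Perm (Fin n)}
    (hσ : IsStablePartition I σ) (hτ : IsStablePartition I τ) {a : Fin n}
    (ha : Odd (orbitOf σ a).card) : cycleAt τ a = cycleAt σ a := by
  rw [card_orbitOf] at ha
  refine cycleAt_congr fun k => ?_
  have h := hσ.inv_apply_eq_of_odd hτ ha (k + 1)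
  rw [Equiv.Perm.inv_eq_iff_eq, pow_succ', Equiv.Perm.mul_apply, perm_inv_apply] at h
  exact h.symm

theorem apply_apply_eq_of_card_orbitOf_eq_two {σ : Equiv.Perm (Fin n)} {a : Fin n}
    (h : (orbitOf σ a).card = 2) : σ (σ a) = a := by
  rw [card_orbitOf] at h
  have := Function.iterate_minimalPeriod (f := σ) (x := a)
  rwa [h] at this

theorem reducedStableCycles_nonempty (hn : 2 ≤ n) (I : SRInstance n) :
    (reducedStableCycles I).Nonempty := by
  obtain ⟨σ, hp, hb⟩ := I.exists_perm_isMinimalTable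
  let a : Fin n := ⟨0, by omega⟩
  refine ⟨cycleAt σ a, ⟨σ, a, hp.isStablePartition hb, rfl⟩, ?_⟩
  change (orbitOf σ a).card = 2 ∨ Odd (orbitOf σ a).card
  rw [card_orbitOf]
  by_cases ha : σ a = σ⁻¹ a
  · have h2 : (σ ^ (2 : ℤ)) a = a := by
      rw [Equiv.Perm.eq_inv_iff_eq] at ha
      exact ha
    rw [zpow_apply_eq_iff_minimalPeriod_dvd] at h2
    rcases (Nat.dvd_prime Nat.prime_two).1 (by exact_mod_cast h2) with h | h
    · right
      rw [h]
      exact odd_one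
    · exact Or.inl h
  · right
    obtain ⟨k, hk⟩ := (hp.list_eq_pair hb ha).2
    have h3 : (σ ^ (2 * k - 1 : ℤ)) a = a := by
      have h4 : σ ^ (2 * k - 1 : ℤ) = σ ^ (2 * k) * σ⁻¹ := by
        rw [zpow_sub_one]
        congr 1
      rw [h4, Equiv.Perm.mul_apply, hk, inv_pow, perm_apply_inv]
    rw [zpow_apply_eq_iff_minimalPeriod_dvd] at h3
    have h5 : Odd (2 * k - 1 : ℤ) := ⟨k - 1, by ring⟩
    obtain ⟨c, hc⟩ := h3
    rw [hc, Int.odd_mul] at h5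
    exact_mod_cast h5.1

theorem ncard_reducedStableCycles_le (I : SRInstance n) :
    (reducedStableCycles I).ncard ≤ n * (n - 1) / 2 + 1 := by
  classical
  have hrep : ∀ c : Finset (Fin n) × Equiv.Perm (Fin n), ∃ s : Finset (Fin n),
      c ∈ reducedStableCycles I → ∃ σ a, IsStablePartition I σ ∧ cycleAt σ a = c ∧
        ((orbitOf σ a).card = 2 ∨ Odd (orbitOf σ a).card) ∧
        s = if σ a = a then ∅ else {a, σ a} := by
    intro c
    by_cases hc : c ∈ reducedStableCycles I
    · obtain ⟨⟨σ, a, hσ, rfl⟩, hcard⟩ := hc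
      exact ⟨_, fun _ => ⟨σ, a, hσ, rfl, hcard, rfl⟩⟩
    · exact ⟨∅, fun h => absurd h hc⟩
  choose F hF using hrep
  set T : Finset (Finset (Fin n)) := insert ∅ (Finset.powersetCard 2 Finset.univ) with hT
  have hTcard : T.card ≤ n * (n - 1) / 2 + 1 := by
    refine (Finset.card_insert_le _ _).trans ?_
    rw [Finset.card_powersetCard, Finset.card_univ, Fintype.card_fin, Nat.choose_two_right]
  refine le_trans ?_ hTcard
  rw [← Set.ncard_coe_finset]
  refine Set.ncard_le_ncard_of_injOn F ?_ ?_
  · intro c hc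
    obtain ⟨σ, a, -, -, -, h⟩ := hF c hc
    rw [h, hT, Finset.mem_coe]
    split_ifs with ha
    · exact Finset.mem_insert_self _ _
    · refine Finset.mem_insert_of_mem (Finset.mem_powersetCard.2 ⟨Finset.subset_univ _, ?_⟩)
      exact Finset.card_pair (Ne.symm ha)
  · intro c hc d hd hcd
    obtain ⟨σ, a, hσ, rfl, hca, h⟩ := hF c hc
    obtain ⟨τ, b, hτ, rfl, hdb, h'⟩ := hF d hd
    rw [h, h'] at hcd
    by_cases ha : σ a = a <;> by_cases hb : τ b = b
    · have ho : Odd (orbitOf σ a).card := by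
        rw [card_orbitOf, Function.minimalPeriod_eq_one_iff_isFixedPt.2 ha]
        exact odd_one
      have hE := hσ.cycleAt_eq_of_odd hτ ho
      have hτa : τ⁻¹ a = a := by
        rw [card_orbitOf] at ho
        have := hσ.inv_apply_eq_of_odd hτ ho 0
        rw [pow_zero, Equiv.Perm.one_apply] at this
        rw [this, Equiv.Perm.inv_eq_iff_eq, ha]
      have hτb : τ⁻¹ b = b := by rw [Equiv.Perm.inv_eq_iff_eq, hb]
      have hab : a = b := by
        by_contra hne
        refine hτ.2 ⟨a, b, hne, ?_, ?_⟩
        · rw [hτa, I.rank_self]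
          exact I.rank_lt (Ne.symm hne)
        · rw [hτb, I.rank_self]
          exact I.rank_lt hne
      rw [← hE, hab]
    · rw [if_pos ha, if_neg hb] at hcd
      exact absurd hcd.symm (Finset.insert_ne_empty _ _)
    · rw [if_neg ha, if_pos hb] at hcd
      exact absurd hcd (Finset.insert_ne_empty _ _)
    · rw [if_neg ha, if_neg hb] at hcd
      have hσs : σ.SameCycle a (σ a) := ⟨1, rfl⟩
      have hτs : τ.SameCycle b (τ b) := ⟨1, rfl⟩
      have hb_mem : b = a ∨ b = σ a := by
        have : b ∈ ({a, σ a} : Finset (Fin n)) := by rw [hcd]; simp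
        simpa using this
      have hτb_mem : τ b = a ∨ τ b = σ a := by
        have : τ b ∈ ({a, σ a} : Finset (Fin n)) := by rw [hcd]; simp
        simpa using this
      have hσab : σ.SameCycle a b := by
        rcases hb_mem with h | h
        · rw [h]
        · rwa [h]
      have hτab : τ.SameCycle b a := by
        rcases hb_mem with h | h
        · rw [h]
        · rcases hτb_mem with h2 | h2
          · rwa [← h2]
          · exact absurd (h2.trans h.symm) hb
      rcases hca with hca | hca
      · rcases hdb with hdb | hdb
        · have hσ2 := apply_apply_eq_of_card_orbitOf_eq_two hca
          have hτ2 := apply_apply_eq_of_card_orbitOf_eq_two hdb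
          have hτa : τ a = σ a := by
            rcases hb_mem with h | h
            · rcases hτb_mem with h2 | h2
              · exact absurd (h2.trans h.symm) hb
              · rwa [h] at h2
            · rcases hτb_mem with h2 | h2
              · rw [← h, ← h2, hτ2]
              · exact absurd (h2.trans h.symm) hb
          have hτσa : τ (σ a) = σ (σ a) := by
            rw [hσ2]
            rcases hb_mem with h | h
            · rw [← hτa, ← h, hτ2]
            · rw [← h]
              rcases hτb_mem with h2 | h2
              · exact h2
              · exact absurd (h2.trans h.symm) hb
          rw [cycleAt_eq_of_sameCycle hτab]
          refine (cycleAt_congr fun k => ?_).symm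
          have hk : (σ ^ k) a = a ∨ (σ ^ k) a = σ a := by
            induction k with
            | zero => exact Or.inl rfl
            | succ k ih =>
              rw [pow_succ', Equiv.Perm.mul_apply]
              rcases ih with ih | ih
              · exact Or.inr (by rw [ih])
              · exact Or.inl (by rw [ih, hσ2])
          rcases hk with hk | hk
          · rw [hk, hτa]
          · rw [hk, hτσa]
        · rw [← hτ.cycleAt_eq_of_odd hσ hdb, cycleAt_eq_of_sameCycle hσab]
      · rw [← hσ.cycleAt_eq_of_odd hτ hca, cycleAt_eq_of_sameCycle hτab]

/-- For an SR instance with `n ≥ 2` agents,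
`1 ≤ |RSC(I)| ≤ n(n-1)/2 + 1`. -/
theorem reduced_stable_cycles_bounds {n : ℕ} (hn : 2 ≤ n) (I : SRInstance n) :
    1 ≤ (reducedStableCycles I).ncard ∧
    (reducedStableCycles I).ncard ≤ n * (n - 1) / 2 + 1 := by
  exact ⟨(Set.ncard_pos (Set.toFinite _)).2 (reducedStableCycles_nonempty hn I),
    ncard_reducedStableCycles_le I⟩
end
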